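/- arXiv:0912.5307 — 3 statements merged into one kernel-verified Lean document; each statement's English description precedes it below -/
import Mathlib

section
/- Let (A, μ, v) be a 2-algebra over a field k, and for a ∈ A write [a] := μ(μ(1⊗a) ⊗ 1). Then for all a,b ∈ A one has the exact equality (v · [a] · v⁻¹) · [b] = [b] · (v · [a] · v⁻¹) in A. -/
open TensorProduct

/-- A 2-algebra over a field `k`: a unital associative `k`-algebra `A` together with an
algebra homomorphism `μ : A ⊗ A → A` and an invertible element `v ∈ A` such that
horizontal conjugation by `v` implements vertical associativity, and `v` satisfies the
pentagon identity. -/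
structure TwoAlgebra (k A : Type*) [Field k] [Ring A] [Algebra k A] where
  μ : A ⊗[k] A →ₐ[k] A
  v : Aˣ
  vassoc : ∀ a b c : A,
    (v : A) * μ (μ (a ⊗ₜ[k] b) ⊗ₜ[k] c) * ((v⁻¹ : Aˣ) : A) = μ (a ⊗ₜ[k] μ (b ⊗ₜ[k] c))
  pentagon : (v : A) * (v : A) = μ ((1 : A) ⊗ₜ[k] (v : A)) * (v : A) * μ ((v : A) ⊗ₜ[k] (1 : A))

/-- For `[a] := μ(μ(1⊗a) ⊗ 1)`, the conjugate `v·[a]·v⁻¹` commutes with `[b]`. -/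
theorem twoAlgebra_conj_commute {k A : Type*} [Field k] [Ring A] [Algebra k A]
    (T : TwoAlgebra k A) (a b : A) :
    ((T.v : A) * T.μ (T.μ ((1 : A) ⊗ₜ[k] a) ⊗ₜ[k] (1 : A)) * ((T.v⁻¹ : Aˣ) : A)) *
        T.μ (T.μ ((1 : A) ⊗ₜ[k] b) ⊗ₜ[k] (1 : A)) =
      T.μ (T.μ ((1 : A) ⊗ₜ[k] b) ⊗ₜ[k] (1 : A)) *
        ((T.v : A) * T.μ (T.μ ((1 : A) ⊗ₜ[k] a) ⊗ₜ[k] (1 : A)) * ((T.v⁻¹ : Aˣ) : A)) := by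
  rw [T.vassoc, ← map_mul, ← map_mul]
  simp only [Algebra.TensorProduct.tmul_mul_tmul, one_mul, mul_one]
end

section
/- Let (A, μ, v) be a 2-algebra over a field k. Let ∼ be the smallest equivalence relation on A such that v·a·v⁻¹ ∼ a for every a ∈ A and such that ∼ is multiplicatively closed (a ∼ b and c ∼ d imply a·c ∼ b·d). For a ∈ A write [a] := μ(μ(1⊗a) ⊗ 1). Then for all a,b ∈ A one has [a]·[b] ∼ [b]·[a]; that is, the horizontal multiplication of a 2-algebra is algebraically homotopically commutative on the elements [a]. -/
open TensorProduct

/-- The equivalence relation on a 2-algebra multiplicatively generated by the homotopy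
relation `v·a·v⁻¹ ∼ a`:  the smallest equivalence relation containing all pairs
`(v·a·v⁻¹, a)` and closed under multiplication. -/
inductive TwoAlgebra.Homotopic {k A : Type*} [Field k] [Ring A] [Algebra k A]
    (T : TwoAlgebra k A) : A → A → Prop
  | conj (a : A) : TwoAlgebra.Homotopic T ((T.v : A) * a * ((T.v⁻¹ : Aˣ) : A)) a
  | refl (a : A) : TwoAlgebra.Homotopic T a a
  | symm {a b : A} : TwoAlgebra.Homotopic T a b → TwoAlgebra.Homotopic T b a
  | trans {a b c : A} :
      TwoAlgebra.Homotopic T a b → TwoAlgebra.Homotopic T b c → TwoAlgebra.Homotopic T a c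
  | mul {a b c d : A} :
      TwoAlgebra.Homotopic T a b → TwoAlgebra.Homotopic T c d →
        TwoAlgebra.Homotopic T (a * c) (b * d)

/-- Vertical reassociation: `(a ∘ b) ∘ c` is homotopic to `a ∘ (b ∘ c)`. -/
theorem TwoAlgebra.homotopic_assoc {k A : Type*} [Field k] [Ring A] [Algebra k A]
    (T : TwoAlgebra k A) (a b c : A) :
    T.Homotopic (T.μ (T.μ (a ⊗ₜ[k] b) ⊗ₜ[k] c)) (T.μ (a ⊗ₜ[k] T.μ (b ⊗ₜ[k] c))) :=
  T.vassoc a b c ▸ (Homotopic.conj _).symm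

/-- Interchange: `1 ∘ a` and `b ∘ 1` commute horizontally. -/
theorem TwoAlgebra.commute_one_tmul_tmul_one {k A : Type*} [Field k] [Ring A] [Algebra k A]
    (T : TwoAlgebra k A) (a b : A) :
    Commute (T.μ ((1 : A) ⊗ₜ[k] a)) (T.μ (b ⊗ₜ[k] (1 : A))) := by
  simp [commute_iff_eq, ← map_mul]

/-- The horizontal multiplication of a 2-algebra is algebraically homotopically commutative:
for `[a] := μ(μ(1⊗a) ⊗ 1)` one has `[a]·[b] ∼ [b]·[a]`. -/
theorem twoAlgebra_homotopically_commutative {k A : Type*} [Field k] [Ring A] [Algebra k A]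
    (T : TwoAlgebra k A) (a b : A) :
    TwoAlgebra.Homotopic T
      (T.μ (T.μ ((1 : A) ⊗ₜ[k] a) ⊗ₜ[k] (1 : A)) * T.μ (T.μ ((1 : A) ⊗ₜ[k] b) ⊗ₜ[k] (1 : A)))
      (T.μ (T.μ ((1 : A) ⊗ₜ[k] b) ⊗ₜ[k] (1 : A)) *
        T.μ (T.μ ((1 : A) ⊗ₜ[k] a) ⊗ₜ[k] (1 : A))) := by
  have ha := T.homotopic_assoc 1 a 1
  have hcomm := (T.commute_one_tmul_tmul_one (T.μ (a ⊗ₜ[k] 1)) (T.μ (1 ⊗ₜ[k] b))).eq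
  exact (ha.mul (.refl _)).trans (hcomm ▸ (TwoAlgebra.Homotopic.refl _).mul ha.symm)
end

section
/- Let s : ℝ → ℝ be a bijection such that s(x) = x for all x ≤ 0 and s(x) = x − 1 for all x ≥ 2 (so s maps the interval [0,2] bijectively onto [0,1]). Define t : ℝ → ℝ by t(x) = s(x−1) + 1, define p : ℝ → ℝ by p = s ∘ s ∘ t⁻¹ ∘ s⁻¹, and define p₁ : ℝ → ℝ by p₁(x) = p(x−1) + 1. Then the pentagon identity p ∘ p = (s ∘ p ∘ s⁻¹) ∘ p ∘ (s ∘ p₁ ∘ s⁻¹) holds as an equality of maps ℝ → ℝ. -/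
/-- A bijection fixing `(-∞,0]` pointwise and equal to `x ↦ x - 1` on `[2,∞)` satisfies the
Thompson-type relation `s ∘ u = t ∘ s`, where `t` and `u` are its conjugates by the translations
by `1` and `2`. -/
theorem rescaling_comp_translate (s t : ℝ ≃ ℝ)
    (hs0 : ∀ x : ℝ, x ≤ 0 → s x = x)
    (hs2 : ∀ x : ℝ, 2 ≤ x → s x = x - 1)
    (ht : ∀ x : ℝ, t x = s (x - 1) + 1) (w : ℝ) :
    s (t w + 1) = t (s (w + 1)) := by
  rcases le_total w 1 with hw | hw
  · have hle : s (w + 1) ≤ 1 := by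
      by_contra! h
      have := s.injective ((hs2 (s (w + 1) + 1) (by linarith)).trans (by ring))
      linarith
    rw [ht w, hs0 (w - 1) (by linarith), ht, hs0 (s (w + 1) - 1) (by linarith)]
    ring_nf
  · have hge : 0 ≤ s (w - 1) := by
      by_contra! h
      have := s.injective (hs0 _ h.le)
      linarith
    rw [ht w, hs2 _ (by linarith), hs2 (w + 1) (by linarith), ht]
    ring_nf

/-- Pentagon identity `p ∘ p = (s ∘ p ∘ s⁻¹) ∘ p ∘ (s ∘ p₁ ∘ s⁻¹)` for the associator
bijection `p = s ∘ s ∘ t⁻¹ ∘ s⁻¹` built from any rescaling bijection `s : ℝ → ℝ` that is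
the identity on `(-∞,0]` and the translation `x ↦ x - 1` on `[2,∞)`, where
`t(x) = s(x-1) + 1` and `p₁(x) = p(x-1) + 1`. -/
theorem associator_pentagon (s t p p₁ : ℝ ≃ ℝ)
    (hs0 : ∀ x : ℝ, x ≤ 0 → s x = x)
    (hs2 : ∀ x : ℝ, 2 ≤ x → s x = x - 1)
    (ht : ∀ x : ℝ, t x = s (x - 1) + 1)
    (hp : ∀ x : ℝ, p x = s (s (t.symm (s.symm x))))
    (hp₁ : ∀ x : ℝ, p₁ x = p (x - 1) + 1) :
    ∀ x : ℝ, p (p x) = s (p (s.symm (p (s (p₁ (s.symm x)))))) := by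
  intro x
  have hpst (y : ℝ) : p (s (t y)) = s (s y) := by simp [hp]
  have ht_add (y : ℝ) : t (y + 1) = s y + 1 := by simp [ht]
  have hp₁_add (y : ℝ) : p₁ (y + 1) = p y + 1 := by simp [hp₁]
  obtain ⟨w, rfl⟩ : ∃ w, x = s (t (t w + 1)) :=
    ⟨t.symm (t.symm (s.symm x) - 1), by simp⟩
  have hright : p₁ (t (t w + 1)) = t (t (w + 1)) := by
    rw [ht_add, hp₁_add, hpst, ← ht_add, ← ht_add]
  rw [hpst, rescaling_comp_translate s t hs0 hs2 ht, hpst, s.symm_apply_apply, hright, hpst,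
    s.symm_apply_apply, hpst]
end
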